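/- arXiv:2205.05432 — 5 statements merged into one kernel-verified Lean document; each statement's English description precedes it below -/
import Mathlib

section
/- Let K be a field, A ∈ Mₙ(K), and g ∈ K[X] a square-free polynomial (coprime to its formal derivative D(g)), with g̃, g̃' ∈ K[X] satisfying 1 = g̃·D(g) + g̃'·g. Define the Newton sequence A₀ := A and A_{k+1} := A_k − g(A_k)·g̃(A_k) for k ≥ 0. Then for every k ≥ 0, the matrix A − A_k lies in g(A)·𝔄, i.e., there exists a polynomial r ∈ K[X] with A − A_k = g(A)·r(A). -/
open Polynomial

theorem dvd_comp_X_sub_mul {R : Type*} [CommRing R] (g r : R[X]) :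
    g ∣ g.comp (X - g * r) := by
  have h : X - g * r - X ∣ g.comp (X - g * r) - g.comp X := by
    simpa only [comp, eval_map] using sub_dvd_eval_sub (X - g * r) X (g.map C)
  rw [comp_X, sub_sub_cancel_left, neg_dvd] at h
  exact (dvd_sub_left dvd_rfl).mp ((dvd_mul_right g r).trans h)

/-- For the Newton sequence `A₀ = A`, `A_{k+1} = A_k - g(A_k)·g̃(A_k)` attached to a
square-free polynomial `g` with Bézout identity `1 = g̃·g' + g̃'·g`, the matrix
`A - A_k` lies in `g(A)·𝔄` for every `k`. -/
theorem newton_seq_sub_mem {K : Type*} [Field K] {n : ℕ}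
    (A : Matrix (Fin n) (Fin n) K) (g gt gt' : K[X])
    (hsep : IsCoprime g (derivative g))
    (hbezout : 1 = gt * derivative g + gt' * g)
    (Aseq : ℕ → Matrix (Fin n) (Fin n) K)
    (h0 : Aseq 0 = A)
    (hstep : ∀ k : ℕ, Aseq (k + 1) = Aseq k - aeval (Aseq k) g * aeval (Aseq k) gt) :
    ∀ k : ℕ, ∃ r : K[X], A - Aseq k = aeval A g * aeval A r := by
  intro k
  induction k with
  | zero => exact ⟨0, by simp [h0]⟩
  | succ k ih =>
    obtain ⟨r, hr⟩ := ih
    obtain ⟨s, hs⟩ := dvd_comp_X_sub_mul g r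
    have hA : Aseq k = aeval A (X - g * r) := by
      rw [map_sub, map_mul, aeval_X, ← hr, sub_sub_cancel]
    refine ⟨r + s * gt.comp (X - g * r), ?_⟩
    rw [hstep, sub_sub_eq_add_sub, add_sub_right_comm, hr, hA, ← aeval_comp, ← aeval_comp, hs]
    simp only [map_add, map_mul, mul_add, mul_assoc]
end

section
/- Let K be a field, A ∈ Mₙ(K), and g ∈ K[X] a square-free polynomial (coprime to its formal derivative D(g)), with g̃, g̃' ∈ K[X] satisfying 1 = g̃·D(g) + g̃'·g. Define the Newton sequence A₀ := A and A_{k+1} := A_k − g(A_k)·g̃(A_k) for k ≥ 0. Then for every k ≥ 0, the matrix g(A_k) lies in g(A)^{2^k}·𝔄, i.e., there exists a polynomial r ∈ K[X] with g(A_k) = g(A)^{2^k}·r(A). -/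
open Polynomial

theorem Polynomial.sq_dvd_comp_X_sub_mul {R : Type*} [CommRing R] {g u v : R[X]}
    (h : 1 = u * derivative g + v * g) : g ^ 2 ∣ g.comp (X - g * u) := by
  obtain ⟨k, hk⟩ := binomExpansion (g.map C) X (-(g * u))
  simp only [eval_map, derivative_map, eval₂_C_X, ← sub_eq_add_neg] at hk
  change g.comp (X - g * u) = _ at hk
  exact ⟨v + k * u ^ 2, by rw [hk]; linear_combination g * h⟩

/-- For the Newton sequence `A₀ = A`, `A_{k+1} = A_k - g(A_k)·g̃(A_k)` attached to a
square-free polynomial `g` with Bézout identity `1 = g̃·g' + g̃'·g`, the matrix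
`g(A_k)` lies in `g(A)^{2^k}·𝔄` for every `k`. -/
theorem newton_seq_eval_mem {K : Type*} [Field K] {n : ℕ}
    (A : Matrix (Fin n) (Fin n) K) (g gt gt' : K[X])
    (hsep : IsCoprime g (derivative g))
    (hbezout : 1 = gt * derivative g + gt' * g)
    (Aseq : ℕ → Matrix (Fin n) (Fin n) K)
    (h0 : Aseq 0 = A)
    (hstep : ∀ k : ℕ, Aseq (k + 1) = Aseq k - aeval (Aseq k) g * aeval (Aseq k) gt) :
    ∀ k : ℕ, ∃ r : K[X], aeval (Aseq k) g = (aeval A g) ^ (2 ^ k) * aeval A r := by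
  have key : ∀ k, ∃ p : K[X], Aseq k = aeval A p ∧ g ^ 2 ^ k ∣ g.comp p := by
    intro k
    induction k with
    | zero => exact ⟨X, by simp [h0]⟩
    | succ k ih =>
      obtain ⟨p, hp, hdvd⟩ := ih
      refine ⟨(X - g * gt).comp p, by simp [hstep, hp, aeval_comp], ?_⟩
      rw [← comp_assoc, pow_succ, pow_mul]
      obtain ⟨q, hq⟩ := sq_dvd_comp_X_sub_mul hbezout
      rw [hq, mul_comp, pow_comp]
      exact (pow_dvd_pow_of_dvd hdvd 2).mul_right _
  intro k
  obtain ⟨p, hp, r, hr⟩ := key k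
  exact ⟨r, by rw [hp, ← aeval_comp, hr, map_mul, map_pow]⟩
end

section
/- Let K be a field, A ∈ Mₙ(K), and f ∈ K[X] non-constant with f(A) = 0. Suppose g ∈ K[X] is square-free (coprime to its formal derivative) with g ∣ f and f ∣ g^m for some m ∈ ℕ, and g̃, g̃' ∈ K[X] satisfy 1 = g̃·D(g) + g̃'·g. Define A₀ := A and A_{k+1} := A_k − g(A_k)·g̃(A_k). Then for every k₀ with 2^{k₀} ≥ m, one has g(A_{k₀}) = 0. -/
open Polynomial

/-- If `gt` inverts `g'` modulo `g`, then one Newton step doubles the order of vanishing. -/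
theorem sq_dvd_comp_newton_step {R : Type*} [CommRing R] {g gt gt' : R[X]}
    (hbezout : 1 = gt * derivative g + gt' * g) : g ^ 2 ∣ g.comp (X - g * gt) := by
  obtain ⟨k, hk⟩ := (g.map C).binomExpansion X (-(g * gt))
  simp only [← sub_eq_add_neg, derivative_map, eval_map, eval₂_C_X] at hk
  refine ⟨gt' + k * gt ^ 2, ?_⟩
  rw [comp, hk]
  linear_combination g * hbezout

/-- Powers of `g` along a Newton iteration vanish once the exponent, scaled by `2 ^ k`,
reaches a vanishing exponent for the starting point. -/
theorem aeval_newton_seq_pow_eq_zero {R S : Type*} [CommRing R] [Ring S] [Algebra R S]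
    {g gt gt' : R[X]} (hbezout : 1 = gt * derivative g + gt' * g) {a : ℕ → S}
    (hstep : ∀ k, a (k + 1) = a k - aeval (a k) g * aeval (a k) gt) {m : ℕ}
    (h0 : aeval (a 0) g ^ m = 0) (k j : ℕ) (hj : m ≤ 2 ^ k * j) :
    aeval (a k) g ^ j = 0 := by
  induction k generalizing j with
  | zero => exact pow_eq_zero_of_le (by simpa using hj) h0
  | succ k ih =>
    obtain ⟨c, hc⟩ := sq_dvd_comp_newton_step hbezout
    have h : aeval (a (k + 1)) g = aeval (a k) (g ^ 2 * c) := by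
      rw [← hc, aeval_comp, hstep]
      simp
    rw [h, ← map_pow, mul_pow, ← pow_mul, map_mul, map_pow,
      ih (2 * j) (by rwa [← mul_assoc, ← pow_succ]), zero_mul]

/-- If `f(A) = 0`, `g` is square-free with `g ∣ f` and `f ∣ g ^ m`, then the Newton
iteration `A₀ = A`, `A_{k+1} = A_k - g(A_k)·g̃(A_k)` satisfies `g(A_{k₀}) = 0` as soon
as `2 ^ k₀ ≥ m`. -/
theorem newton_seq_eval_eq_zero {K : Type*} [Field K] {n : ℕ}
    (A : Matrix (Fin n) (Fin n) K) (f g gt gt' : K[X]) (m : ℕ)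
    (hf : 0 < f.natDegree) (hfA : aeval A f = 0)
    (hsep : IsCoprime g (derivative g))
    (hgf : g ∣ f) (hfg : f ∣ g ^ m)
    (hbezout : 1 = gt * derivative g + gt' * g)
    (Aseq : ℕ → Matrix (Fin n) (Fin n) K)
    (h0 : Aseq 0 = A)
    (hstep : ∀ k : ℕ, Aseq (k + 1) = Aseq k - aeval (Aseq k) g * aeval (Aseq k) gt) :
    ∀ k₀ : ℕ, m ≤ 2 ^ k₀ → aeval (Aseq k₀) g = 0 := by
  intro k₀ hk
  have hgm : aeval (Aseq 0) g ^ m = 0 := by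
    rw [h0, ← map_pow]
    exact aeval_eq_zero_of_dvd_aeval_eq_zero hfg hfA
  simpa using aeval_newton_seq_pow_eq_zero hbezout hstep hgm k₀ 1 (by simpa using hk)
end

section
/- Let K be a field, A ∈ Mₙ(K), and f ∈ K[X] non-constant with f(A) = 0. Suppose g ∈ K[X] is square-free (coprime to its formal derivative) with g ∣ f and f ∣ g^m for some m ∈ ℕ, and g̃, g̃' ∈ K[X] satisfy 1 = g̃·D(g) + g̃'·g. Define A₀ := A and A_{k+1} := A_k − g(A_k)·g̃(A_k). Then for every k₀ with 2^{k₀} ≥ m, the matrix N := A − A_{k₀} satisfies N^m = 0; in particular N is nilpotent. -/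
open Polynomial

theorem Polynomial.sub_dvd_comp_sub_comp {R : Type*} [CommRing R] (p q g : R[X]) :
    p - q ∣ g.comp p - g.comp q := by
  simpa only [eval_map, comp] using sub_dvd_eval_sub p q (g.map C)

/-- If `g` divides `X - p`, then it also divides `X - (p - g(p) h(p))`. -/
theorem Polynomial.dvd_X_sub_comp_step {R : Type*} [CommRing R] {g p : R[X]} (h : R[X])
    (hp : g ∣ X - p) : g ∣ X - (p - g.comp p * h.comp p) := by
  have hcomp : g ∣ g.comp p := by
    have hsub := hp.trans (sub_dvd_comp_sub_comp X p g)
    rw [comp_X] at hsub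
    exact (dvd_sub_right dvd_rfl).mp hsub
  rw [← sub_add]
  exact dvd_add hp (hcomp.mul_right _)


/-- If `f(A) = 0`, `g` is square-free with `g ∣ f` and `f ∣ g ^ m`, then for the Newton
iteration `A₀ = A`, `A_{k+1} = A_k - g(A_k)·g̃(A_k)` and any `k₀` with `2 ^ k₀ ≥ m`,
the matrix `N = A - A_{k₀}` satisfies `N ^ m = 0`; in particular `N` is nilpotent. -/
theorem newton_seq_sub_nilpotent {K : Type*} [Field K] {n : ℕ}
    (A : Matrix (Fin n) (Fin n) K) (f g gt gt' : K[X]) (m : ℕ)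
    (hf : 0 < f.natDegree) (hfA : aeval A f = 0)
    (hsep : IsCoprime g (derivative g))
    (hgf : g ∣ f) (hfg : f ∣ g ^ m)
    (hbezout : 1 = gt * derivative g + gt' * g)
    (Aseq : ℕ → Matrix (Fin n) (Fin n) K)
    (h0 : Aseq 0 = A)
    (hstep : ∀ k : ℕ, Aseq (k + 1) = Aseq k - aeval (Aseq k) g * aeval (Aseq k) gt) :
    ∀ k₀ : ℕ, m ≤ 2 ^ k₀ →
      (A - Aseq k₀) ^ m = 0 ∧ IsNilpotent (A - Aseq k₀) := by
  intro k₀ _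
  have hpoly : ∀ k, ∃ p : K[X], Aseq k = aeval A p ∧ g ∣ X - p := by
    intro k
    induction k with
    | zero => exact ⟨X, by rw [h0, aeval_X], by simp⟩
    | succ k ih =>
      obtain ⟨p, hp, hdvd⟩ := ih
      refine ⟨p - g.comp p * gt.comp p, ?_, dvd_X_sub_comp_step gt hdvd⟩
      rw [hstep, hp, map_sub, map_mul, aeval_comp, aeval_comp]
  obtain ⟨p, hp, hdvd⟩ := hpoly k₀
  have hpow : (A - Aseq k₀) ^ m = 0 := by
    obtain ⟨q, hq⟩ := hfg.trans (pow_dvd_pow_of_dvd hdvd m)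
    calc (A - Aseq k₀) ^ m = aeval A ((X - p) ^ m) := by rw [hp, map_pow, map_sub, aeval_X]
      _ = 0 := by rw [hq, map_mul, hfA, zero_mul]
  exact ⟨hpow, m, hpow⟩
end

section
/- (Existence of the Jordan–Chevalley decomposition.) Let K be a perfect field and A ∈ Mₙ(K). Then there exist matrices D, N ∈ Mₙ(K) such that A = D + N, D is semisimple, N is nilpotent, D·N = N·D, and moreover D and N are polynomials in A (i.e., D = r(A) and N = s(A) for some r, s ∈ K[X]). -/
open Polynomial

/-- Existence of the Jordan–Chevalley decomposition over a perfect field: every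
`A ∈ Mₙ(K)` is a sum `A = D + N` with `D` semisimple, `N` nilpotent, `D·N = N·D`,
and both `D` and `N` are polynomials in `A`. -/
theorem jordan_chevalley_exists {K : Type*} [Field K] [PerfectField K] {n : ℕ}
    (A : Matrix (Fin n) (Fin n) K) :
    ∃ D N : Matrix (Fin n) (Fin n) K,
      A = D + N ∧
      Module.End.IsSemisimple (Matrix.toLin' D) ∧
      IsNilpotent N ∧
      D * N = N * D ∧
      (∃ r : K[X], D = aeval A r) ∧ (∃ s : K[X], N = aeval A s) := by
  obtain ⟨f, hf, g, hg, hnil, hss, hA⟩ :=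
    Module.End.exists_isNilpotent_isSemisimple (f := Matrix.toLin' A)
  rw [Algebra.adjoin_singleton_eq_range_aeval] at hf hg
  obtain ⟨s, rfl⟩ := hf
  obtain ⟨r, rfl⟩ := hg
  have toLin'_aeval (p : K[X]) :
      aeval (R := K) (A := Module.End K (Fin n → K)) (Matrix.toLin' A) p =
        Matrix.toLin' (aeval A p) :=
    aeval_algHom_apply (Matrix.toLinAlgEquiv' (R := K) (n := Fin n)) A p
  change IsNilpotent (aeval _ s) at hnil
  change Module.End.IsSemisimple (aeval _ r) at hss
  change _ = aeval _ s + aeval _ r at hA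
  rw [toLin'_aeval] at hnil hss
  rw [toLin'_aeval, toLin'_aeval] at hA
  refine ⟨aeval A r, aeval A s, ?_, hss, ?_, ?_, ⟨r, rfl⟩, ⟨s, rfl⟩⟩
  · apply Matrix.toLin'.injective
    rw [map_add, add_comm]
    exact hA
  · exact (IsNilpotent.map_iff (Matrix.toLinAlgEquiv' (R := K) (n := Fin n)).injective).mp hnil
  · rw [← map_mul, ← map_mul, mul_comm]
end
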